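/- arXiv:0905.3960 — 2 statements merged into one kernel-verified Lean document; each statement's English description precedes it below -/
import Mathlib

section
/- Let H, G be countable groups, identify the underlying set of H ≀ G with H^{(G)} × G, and let X ⊆ H^{(G)} × G. Then the following are equivalent: (i) (H ≀ G, X) has relative Property T; (ii) there exist subsets Y ⊆ H and Z ⊆ G such that every (w,g) ∈ X satisfies g ∈ Z, Supp(w) ⊆ Z and w(z) ∈ Y ∪ {1} for all z ∈ G, the pairs (H,Y) and (G,Z) have relative Property T, and the function (w,g) ↦ #Supp(w) is bounded on X. -/
open MeasureTheory Function Set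
open scoped ENNReal
/-- A conditionally negative definite kernel: symmetric, vanishing on the diagonal,
with `∑ᵢⱼ cᵢcⱼ κ(xᵢ,xⱼ) ≤ 0` whenever `∑ᵢ cᵢ = 0`. -/
def IsCNDKernel {X : Type*} (κ : X → X → ℝ) : Prop :=
  (∀ x y, κ x y = κ y x) ∧ (∀ x, κ x x = 0) ∧
    ∀ (n : ℕ) (x : Fin n → X) (c : Fin n → ℝ), (∑ i, c i) = 0 →
      ∑ i, ∑ j, c i * c j * κ (x i) (x j) ≤ 0

/-- A conditionally negative definite function on a group. -/
def IsCNDFunction {G : Type*} [Group G] (ψ : G → ℝ) : Prop :=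
  IsCNDKernel fun g h => ψ (g⁻¹ * h)

/-- A proper function on a group: sublevel sets are finite. -/
def IsProperFunction {G : Type*} [Group G] (ψ : G → ℝ) : Prop :=
  ∀ R : ℝ, {g : G | ψ g ≤ R}.Finite
/-- Relative Property (T) for a pair `(Γ, S)`: every conditionally negative definite
function on `Γ` is bounded on `S`. -/
def RelPropT (Γ : Type*) [Group Γ] (S : Set Γ) : Prop :=
  ∀ ψ : Γ → ℝ, IsCNDFunction ψ → ∃ M : ℝ, ∀ s ∈ S, ψ s ≤ M
/-- The group of finitely supported functions `X → H` under pointwise multiplication. -/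
def FinSuppSubgroup (H : Type*) [Group H] (X : Type*) : Subgroup (X → H) where
  carrier := {w | (Function.mulSupport w).Finite}
  one_mem' := by simpa [Function.mulSupport_one] using Set.finite_empty
  mul_mem' := by
    intro a b ha hb
    exact (ha.union hb).subset (Function.mulSupport_mul a b)
  inv_mem' := by
    intro a ha
    simpa [Function.mulSupport_inv] using ha

/-- The shift action of `G` on finitely supported functions `X → H`, for a `G`-set `X`:
`(g·w)(x) = w(g⁻¹ • x)`. -/
def wreathShift (H : Type*) [Group H] (X : Type*) (G : Type*) [Group G] [MulAction G X] :
    G →* MulAut (FinSuppSubgroup H X) where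
  toFun g :=
    { toFun := fun w => ⟨fun x => (w : X → H) (g⁻¹ • x), by
        refine (w.2.image (fun x => g • x)).subset ?_
        intro x hx
        exact ⟨g⁻¹ • x, hx, by simp⟩⟩
      invFun := fun w => ⟨fun x => (w : X → H) (g • x), by
        refine (w.2.image (fun x => g⁻¹ • x)).subset ?_
        intro x hx
        exact ⟨g • x, hx, by simp⟩⟩
      left_inv := by intro w; apply Subtype.ext; funext x; simp
      right_inv := by intro w; apply Subtype.ext; funext x; simp
      map_mul' := by intro a b; rfl }
  map_one' := by
    apply MulEquiv.ext; intro w; apply Subtype.ext; funext x; simp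
  map_mul' := by
    intro a b
    apply MulEquiv.ext; intro w; apply Subtype.ext; funext x
    simp [mul_smul]

/-- The permutational wreath product `H ≀_X G = H^{(X)} ⋊ G`. -/
abbrev PermWreath (H : Type*) [Group H] (X : Type*) (G : Type*) [Group G] [MulAction G X] :=
  FinSuppSubgroup H X ⋊[wreathShift H X G] G

/-- The standard wreath product `H ≀ G = H^{(G)} ⋊ G`. -/
abbrev StandardWreath (H : Type*) [Group H] (G : Type*) [Group G] := PermWreath H G G

section ConditionallyNegativeDefinite

variable {G : Type*} [Group G] {ψ : G → ℝ}

lemma IsCNDFunction.map_one (hψ : IsCNDFunction ψ) : ψ 1 = 0 := by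
  simpa using hψ.2.1 1

lemma IsCNDFunction.map_inv (hψ : IsCNDFunction ψ) (g : G) : ψ g⁻¹ = ψ g := by
  simpa using hψ.1 g 1

lemma IsCNDFunction.nonneg (hψ : IsCNDFunction ψ) (g : G) : 0 ≤ ψ g := by
  have h := hψ.2.2 2 ![1, g] ![1, -1] (by simp)
  simp [Fin.sum_univ_succ, hψ.map_one, hψ.map_inv] at h
  linarith

lemma IsCNDFunction.map_mul_le (hψ : IsCNDFunction ψ) (a b : G) :
    ψ (a * b) ≤ 2 * ψ a + 2 * ψ b := by
  have h := hψ.2.2 3 ![1, a, a * b] ![1, -2, 1] (by simp [Fin.sum_univ_succ]; norm_num)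
  simp [Fin.sum_univ_succ, hψ.map_one, hψ.map_inv] at h
  linarith

lemma IsCNDFunction.comp_monoidHom {K : Type*} [Group K] (hψ : IsCNDFunction ψ) (f : K →* G) :
    IsCNDFunction (ψ ∘ f) := by
  refine ⟨fun x y => ?_, fun x => ?_, fun n x c hc => ?_⟩
  · simpa using hψ.1 (f x) (f y)
  · simpa using hψ.2.1 (f x)
  · simpa using hψ.2.2 n (f ∘ x) c hc

/-- The Gram form of the variogram `ψ` based at the identity is positive semidefinite. -/
lemma IsCNDFunction.sum_gram_nonneg (hψ : IsCNDFunction ψ) {ι : Type*} [Fintype ι] (x : ι → G)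
    (c : ι → ℝ) :
    0 ≤ ∑ i, ∑ j, c i * c j * ((ψ (x i) + ψ (x j) - ψ ((x i)⁻¹ * x j)) / 2) := by
  let e := Fintype.equivFin ι
  have h := hψ.2.2 (Fintype.card ι + 1) (Fin.cons 1 (x ∘ e.symm))
    (Fin.cons (-∑ i, c i) (c ∘ e.symm)) (by
      simp [Fin.sum_univ_succ, Equiv.sum_comp e.symm c])
  simp only [Fin.sum_univ_succ, Fin.cons_zero, Fin.cons_succ, Function.comp, hψ.map_one,
    inv_one, one_mul, mul_one, hψ.map_inv, mul_zero, zero_add] at h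
  rw [Equiv.sum_comp e.symm (fun i => -(∑ i, c i) * c i * ψ (x i)),
    Equiv.sum_comp e.symm (fun i => c i * -(∑ i, c i) * ψ (x i) +
      ∑ j, c i * c (e.symm j) * ψ ((x i)⁻¹ * x (e.symm j)))] at h
  simp_rw [fun i => Equiv.sum_comp e.symm (fun j => c i * c j * ψ ((x i)⁻¹ * x j))] at h
  have e₁ : ∑ i, ∑ j, c i * c j * ψ (x i) = (∑ i, c i) * ∑ i, c i * ψ (x i) := by
    rw [mul_comm, Finset.sum_mul_sum]
    exact Finset.sum_congr rfl fun i _ => Finset.sum_congr rfl fun j _ => by ring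
  have e₂ : ∑ i, ∑ j, c i * c j * ψ (x j) = (∑ i, c i) * ∑ i, c i * ψ (x i) := by
    rw [Finset.sum_mul_sum]
    exact Finset.sum_congr rfl fun i _ => Finset.sum_congr rfl fun j _ => by ring
  have e₃ : ∑ i, ∑ j, c i * c j * ((ψ (x i) + ψ (x j) - ψ ((x i)⁻¹ * x j)) / 2) =
      ((∑ i, ∑ j, c i * c j * ψ (x i)) + (∑ i, ∑ j, c i * c j * ψ (x j)) -
        ∑ i, ∑ j, c i * c j * ψ ((x i)⁻¹ * x j)) / 2 := by
    simp_rw [← Finset.sum_add_distrib, ← Finset.sum_sub_distrib, Finset.sum_div]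
    exact Finset.sum_congr rfl fun i _ => Finset.sum_congr rfl fun j _ => by ring
  rw [e₃, e₁, e₂]
  rw [Finset.sum_add_distrib] at h
  have e₄ (a : ℝ) : ∑ i, -a * c i * ψ (x i) = -(a * ∑ i, c i * ψ (x i)) := by
    rw [Finset.mul_sum, ← Finset.sum_neg_distrib]
    exact Finset.sum_congr rfl fun i _ => by ring
  have e₅ (a : ℝ) : ∑ i, c i * -a * ψ (x i) = -(a * ∑ i, c i * ψ (x i)) := by
    rw [Finset.mul_sum, ← Finset.sum_neg_distrib]
    exact Finset.sum_congr rfl fun i _ => by ring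
  rw [e₄, e₅] at h
  linarith

end ConditionallyNegativeDefinite

/-- The indicator of an equivalence relation is a positive definite kernel. -/
lemma sum_mul_ite_eq_nonneg {ι R : Type*} [Fintype ι] [DecidableEq R] (r : ι → R) (d : ι → ℝ) :
    0 ≤ ∑ i, ∑ j, d i * d j * (if r i = r j then 1 else 0) := by
  have key : ∑ i, ∑ j, d i * d j * (if r i = r j then 1 else 0) =
      ∑ s ∈ Finset.univ.image r, (∑ i, if r i = s then d i else 0) ^ 2 := by
    simp_rw [sq, Finset.sum_mul_sum]
    rw [Finset.sum_comm]
    simp_rw [Finset.sum_comm (s := Finset.univ.image r)]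
    rw [Finset.sum_comm]
    refine Finset.sum_congr rfl fun i _ => Finset.sum_congr rfl fun j _ => ?_
    rw [Finset.sum_eq_single (r i)]
    · by_cases h : r i = r j <;> simp [h, eq_comm]
    · intro s _ hs
      simp [hs.symm]
    · simp
  rw [key]
  positivity

/-- A kernel whose sublevel sets have positive definite indicators is conditionally negative
definite. -/
lemma sum_mul_nonpos_of_sublevel {ι : Type*} [Fintype ι] (κ : ι → ι → ℝ) (c : ι → ℝ)
    (hc : ∑ i, c i = 0)
    (h : ∀ t : ℝ, 0 ≤ ∑ i, ∑ j, c i * c j * (if κ i j ≤ t then 1 else 0)) :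
    ∑ i, ∑ j, c i * c j * κ i j ≤ 0 := by
  let B : ℝ := ∑ i, ∑ j, |κ i j|
  have hB (i j : ι) : |κ i j| ≤ B :=
    (Finset.single_le_sum (f := fun j => |κ i j|) (fun _ _ => abs_nonneg _)
      (Finset.mem_univ j)).trans
      (Finset.single_le_sum (f := fun i => ∑ j, |κ i j|)
        (fun _ _ => Finset.sum_nonneg fun _ _ => abs_nonneg _) (Finset.mem_univ i))
  have hmono (a : ℝ) : Monotone fun t : ℝ => (if a ≤ t then (1 : ℝ) else 0) := by
    intro s t hst
    dsimp only
    split_ifs with h₁ h₂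
    · rfl
    · exact absurd (h₁.trans hst) h₂
    · exact zero_le_one
    · rfl
  have hInt (a : ℝ) (s t : ℝ) :
      IntervalIntegrable (fun t : ℝ => (if a ≤ t then (1 : ℝ) else 0)) volume s t :=
    (hmono a).intervalIntegrable
  have hval (i j : ι) : ∫ t in (-B)..B, (if κ i j ≤ t then (1 : ℝ) else 0) = B - κ i j := by
    obtain ⟨h₁, h₂⟩ := abs_le.1 (hB i j)
    rw [← intervalIntegral.integral_add_adjacent_intervals (hInt _ _ (κ i j)) (hInt _ _ _)]
    have e₁ : ∫ t in (-B)..(κ i j), (if κ i j ≤ t then (1 : ℝ) else 0) = 0 := by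
      rw [intervalIntegral.integral_of_le h₁, MeasureTheory.integral_Ioc_eq_integral_Ioo]
      rw [setIntegral_congr_fun measurableSet_Ioo (g := fun _ => 0)
        (fun t ht => if_neg (not_le.2 ht.2))]
      simp
    have e₂ : ∫ t in (κ i j)..B, (if κ i j ≤ t then (1 : ℝ) else 0) = B - κ i j := by
      rw [intervalIntegral.integral_congr (g := fun _ => 1)]
      · simp
      · intro t ht
        rw [Set.uIcc_of_le h₂] at ht
        exact if_pos ht.1
    rw [e₁, e₂, zero_add]
  have hpos : 0 ≤ ∫ t in (-B)..B, ∑ i, ∑ j, c i * c j * (if κ i j ≤ t then (1 : ℝ) else 0) :=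
    intervalIntegral.integral_nonneg
      (neg_le_self (Finset.sum_nonneg fun _ _ => Finset.sum_nonneg fun _ _ => abs_nonneg _))
      fun t _ => h t
  have hsum (i : ι) : IntervalIntegrable
      (fun t : ℝ => ∑ j, c i * c j * (if κ i j ≤ t then (1 : ℝ) else 0)) volume (-B) B := by
    have := IntervalIntegrable.sum (μ := volume) (a := -B) (b := B) Finset.univ
      (f := fun j (t : ℝ) => c i * c j * (if κ i j ≤ t then (1 : ℝ) else 0))
      fun j _ => (hInt _ _ _).const_mul _
    rwa [Finset.sum_fn] at this
  rw [intervalIntegral.integral_finsetSum fun i _ => hsum i] at hpos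
  simp_rw [intervalIntegral.integral_finsetSum fun j _ => (hInt _ _ _).const_mul _,
    intervalIntegral.integral_const_mul, hval, mul_sub, Finset.sum_sub_distrib,
    ← Finset.sum_mul, ← Finset.mul_sum, hc] at hpos
  simpa using hpos

section GaussianMax

open ProbabilityTheory

open Classical in
/-- Extension by zero of a vector indexed by a finite subset. -/
noncomputable def extendZero {α : Type*} (D : Finset α) (x : EuclideanSpace ℝ D) (z : α) : ℝ :=
  if h : z ∈ D then x ⟨z, h⟩ else 0

lemma extendZero_of_mem {α : Type*} {D : Finset α} {z : α} (h : z ∈ D) (x : EuclideanSpace ℝ D) :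
    extendZero D x z = x ⟨z, h⟩ := dif_pos h

variable {G : Type*} [Group G] {ψ : G → ℝ}

/-- The covariance matrix on `F` of the centred Gaussian process on `G` that vanishes at `1` and
has variogram `ψ`. -/
noncomputable def gramMatrix (ψ : G → ℝ) (F : Finset G) : Matrix F F ℝ :=
  Matrix.of fun x y => (ψ x + ψ y - ψ ((x : G)⁻¹ * y)) / 2

lemma IsCNDFunction.posSemidef_gramMatrix (hψ : IsCNDFunction ψ) (F : Finset G) :
    (gramMatrix ψ F).PosSemidef := by
  refine Matrix.PosSemidef.of_dotProduct_mulVec_nonneg ?_ fun c => ?_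
  · ext x y
    have h : ψ ((y : G)⁻¹ * x) = ψ ((x : G)⁻¹ * y) := hψ.1 _ _
    simp [gramMatrix, h, add_comm]
  · refine (hψ.sum_gram_nonneg (fun x : F => (x : G)) c).trans_eq ?_
    simp only [dotProduct, Matrix.mulVec, gramMatrix, Matrix.of_apply, Finset.mul_sum,
      Pi.star_apply, star_trivial]
    exact Finset.sum_congr rfl fun i _ => Finset.sum_congr rfl fun j _ => by ring

open Classical in
/-- The law on `F` of the centred Gaussian process vanishing at `1` with variogram `ψ`. -/
noncomputable def gaussianOn (ψ : G → ℝ) (F : Finset G) : Measure (EuclideanSpace ℝ F) :=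
  multivariateGaussian 0 (gramMatrix ψ F)

instance (F : Finset G) : IsGaussian (gaussianOn ψ F) := by
  unfold gaussianOn; infer_instance

/-- The increments from `γ` of the Gaussian process with variogram `ψ` have the law of the
process itself. -/
lemma IsCNDFunction.measurePreserving_increment (hψ : IsCNDFunction ψ) {F D : Finset G} {γ : G}
    (hγ : γ ∈ D) (h : ∀ z ∈ F, γ * z ∈ D) :
    MeasurePreserving (fun x : EuclideanSpace ℝ D =>
      WithLp.toLp 2 fun z : F => x ⟨γ * z, h z z.2⟩ - x ⟨γ, hγ⟩)
      (gaussianOn ψ D) (gaussianOn ψ F) := by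
  classical
  let L : EuclideanSpace ℝ D →L[ℝ] EuclideanSpace ℝ F :=
    (EuclideanSpace.equiv F ℝ).symm.toContinuousLinearMap ∘L
      ContinuousLinearMap.pi fun z : F =>
        (EuclideanSpace.proj ⟨γ * z, h z z.2⟩ : EuclideanSpace ℝ D →L[ℝ] ℝ) -
          EuclideanSpace.proj ⟨γ, hγ⟩
  have hL : ⇑L = fun x : EuclideanSpace ℝ D =>
      WithLp.toLp 2 fun z : F => x ⟨γ * z, h z z.2⟩ - x ⟨γ, hγ⟩ := by
    ext x z
    simp [L]
  rw [← hL]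
  have hS := hψ.posSemidef_gramMatrix D
  have hT := hψ.posSemidef_gramMatrix F
  refine ⟨by fun_prop, ?_⟩
  unfold gaussianOn
  have hmem (y : D) :
      MemLp (fun x : EuclideanSpace ℝ D => x y) 2 (multivariateGaussian 0 (gramMatrix ψ D)) :=
    IsGaussian.memLp_dual _ (EuclideanSpace.proj y : EuclideanSpace ℝ D →L[ℝ] ℝ) 2 (by simp)
  apply IsGaussian.ext
  · simp only [id_eq, integral_id_multivariateGaussian]
    rw [ContinuousLinearMap.integral_id_map, integral_id_multivariateGaussian, map_zero]
    exact IsGaussian.integrable_id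
  rw [← ContinuousLinearMap.toBilinForm_inj]
  refine LinearMap.BilinForm.ext_basis (EuclideanSpace.basisFun F ℝ).toBasis fun i j => ?_
  rw [ContinuousLinearMap.toBilinForm_apply, ContinuousLinearMap.toBilinForm_apply,
    covarianceBilin_apply_eq_cov, covariance_map]
  · have key (i : F) : (fun u => inner ℝ ((EuclideanSpace.basisFun F ℝ).toBasis i) u) ∘ L =
        (fun u => u ⟨γ * i, h i i.2⟩) - fun u => u ⟨γ, hγ⟩ := by
      ext; simp [PiLp.inner_apply, hL]
    rw [key, key, covariance_sub_left (hmem _) (hmem _) ((hmem _).sub (hmem _)),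
      covariance_sub_right (hmem _) (hmem _) (hmem _),
      covariance_sub_right (hmem _) (hmem _) (hmem _)]
    simp_rw [covariance_eval_multivariateGaussian hS, covarianceBilin_multivariateGaussian hT]
    simp [gramMatrix, hψ.map_one, hψ.map_inv, mul_assoc]
    ring
  any_goals exact Measurable.aestronglyMeasurable (by fun_prop)
  · fun_prop
  · exact IsGaussian.memLp_two_id

/-- The expected maximum over `F` of the Gaussian process with variogram `ψ`. -/
noncomputable def gaussianMax (ψ : G → ℝ) (F : Finset G) : ℝ :=
  ∫ x, ⨆ z : F, x z ∂gaussianOn ψ F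

lemma integrable_extendZero (D : Finset G) (z : G) :
    Integrable (fun x => extendZero D x z) (gaussianOn ψ D) := by
  by_cases h : z ∈ D
  · simp only [extendZero_of_mem h]
    exact IsGaussian.integrable_dual _
      (EuclideanSpace.proj ⟨z, h⟩ : EuclideanSpace ℝ D →L[ℝ] ℝ)
  · simp [extendZero, h]

lemma integral_extendZero (D : Finset G) (z : G) :
    ∫ x, extendZero D x z ∂gaussianOn ψ D = 0 := by
  classical
  by_cases h : z ∈ D
  · simp only [extendZero_of_mem h]
    refine (IsGaussian.integral_dual
      (EuclideanSpace.proj ⟨z, h⟩ : EuclideanSpace ℝ D →L[ℝ] ℝ)).trans ?_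
    rw [gaussianOn, integral_id_multivariateGaussian, map_zero]
  · simp [extendZero, h]

lemma integrable_iSup_extendZero (D F : Finset G) (γ : G) :
    Integrable (fun x => ⨆ z : F, extendZero D x (γ * z)) (gaussianOn ψ D) := by
  have hm (z : G) : Measurable fun x => extendZero D x z := by
    by_cases h : z ∈ D
    · simp only [extendZero_of_mem h]
      fun_prop
    · simp [extendZero, h]
  refine (integrable_finsetSum F fun z _ => (integrable_extendZero (ψ := ψ) D (γ * z)).abs).mono'
    (Measurable.iSup fun z : F => hm _).aestronglyMeasurable (ae_of_all _ fun x => ?_)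
  rcases isEmpty_or_nonempty F with hF | hF
  · simp only [Real.iSup_of_isEmpty, norm_zero]
    positivity
  · obtain ⟨z, hz⟩ := exists_eq_ciSup_of_finite (f := fun z : F => extendZero D x (γ * z))
    rw [← hz]
    exact Finset.single_le_sum (f := fun z => |extendZero D x (γ * z)|)
      (fun _ _ => abs_nonneg _) z.2

lemma IsCNDFunction.gaussianMax_eq (hψ : IsCNDFunction ψ) {F D : Finset G} {γ : G}
    (hF : F.Nonempty) (hγ : γ ∈ D) (h : ∀ z ∈ F, γ * z ∈ D) :
    gaussianMax ψ F = ∫ x, ⨆ z : F, extendZero D x (γ * z) ∂gaussianOn ψ D := by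
  have := hF.to_subtype
  have hm := hψ.measurePreserving_increment hγ h
  rw [gaussianMax, ← hm.map_eq, integral_map hm.measurable.aemeasurable
    (Measurable.iSup fun z : F => by fun_prop).aestronglyMeasurable]
  have hsub (x : EuclideanSpace ℝ D) : (⨆ z : F, (x ⟨γ * z, h z z.2⟩ - x ⟨γ, hγ⟩)) =
      (⨆ z : F, extendZero D x (γ * z)) - extendZero D x γ := by
    rw [ciSup_sub (Finite.bddAbove_range _), extendZero_of_mem hγ]
    simp only [extendZero_of_mem (h _ (Subtype.prop _))]
  simp only [hsub]
  rw [integral_sub (integrable_iSup_extendZero D F γ) (integrable_extendZero D γ),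
    integral_extendZero, sub_zero]

lemma integral_abs_gaussianReal (v : NNReal) :
    ∫ x, |x| ∂gaussianReal 0 v = √v * ∫ x, |x| ∂gaussianReal 0 1 := by
  have h := gaussianReal_map_const_mul (μ := 0) (v := 1) √v
  have hv : (gaussianReal 0 1).map (√v * ·) = gaussianReal 0 v := by
    rw [h]
    congr 1
    · simp
    · ext; simp
  rw [← hv, integral_map (by fun_prop) (by fun_prop), ← integral_const_mul]
  simp [abs_mul, abs_of_nonneg (Real.sqrt_nonneg _)]

lemma integral_abs_gaussianReal_pos : 0 < ∫ x, |x| ∂gaussianReal 0 1 := by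
  have hInt : Integrable (fun x : ℝ => |x|) (gaussianReal 0 1) :=
    (IsGaussian.integrable_id (μ := gaussianReal 0 1)).abs
  rw [integral_pos_iff_support_of_nonneg (fun x => abs_nonneg x) hInt]
  have := nullSingletonClass_gaussianReal (μ := 0) (v := 1) one_ne_zero
  have hs : Function.support (fun x : ℝ => |x|) = {0}ᶜ := by ext; simp
  rw [hs, prob_compl_eq_one_sub (measurableSet_singleton _), measure_singleton]
  simp

lemma IsCNDFunction.integral_abs_eval (hψ : IsCNDFunction ψ) {D : Finset G} {z : G} (hz : z ∈ D) :
    ∫ x, |extendZero D x z| ∂gaussianOn ψ D = √(ψ z) * ∫ x, |x| ∂gaussianReal 0 1 := by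
  classical
  have hm := measurePreserving_eval_multivariateGaussian (μ := 0) (hψ.posSemidef_gramMatrix D)
    (i := ⟨z, hz⟩)
  have hv : gramMatrix ψ D ⟨z, hz⟩ ⟨z, hz⟩ = ψ z := by simp [gramMatrix, hψ.map_one]
  rw [hv] at hm
  have h := integral_abs_gaussianReal (ψ z).toNNReal
  rw [Real.coe_toNNReal _ (hψ.nonneg z)] at h
  simp only [extendZero_of_mem hz]
  rw [← h, gaussianOn, ← show ((0 : EuclideanSpace ℝ D) ⟨z, hz⟩) = 0 from rfl, ← hm.map_eq,
    integral_map hm.measurable.aemeasurable (by fun_prop)]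

lemma IsCNDFunction.sqrt_le_gaussianMax (hψ : IsCNDFunction ψ) {F : Finset G} (h₁ : 1 ∈ F)
    {z : G} (hz : z ∈ F) :
    √(ψ z) * (∫ x, |x| ∂gaussianReal 0 1) / 2 ≤ gaussianMax ψ F := by
  have i₁ := integrable_extendZero (ψ := ψ) F 1
  have i₂ := integrable_extendZero (ψ := ψ) F z
  have i₃ : Integrable (fun x => extendZero F x 1 + extendZero F x z) (gaussianOn ψ F) := i₁.add i₂
  have i₄ : Integrable (fun x => |extendZero F x z| - |extendZero F x 1|) (gaussianOn ψ F) :=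
    i₂.abs.sub i₁.abs
  have hle : ∫ x, ((extendZero F x 1 + extendZero F x z) +
      (|extendZero F x z| - |extendZero F x 1|)) / 2 ∂gaussianOn ψ F ≤ gaussianMax ψ F := by
    rw [hψ.gaussianMax_eq ⟨1, h₁⟩ h₁ (by simp)]
    refine integral_mono ((i₃.add i₄).div_const 2)
      (integrable_iSup_extendZero F F 1) fun x => ?_
    have hb := Finite.bddAbove_range fun z : F => extendZero F x (1 * z)
    have a₁ := le_ciSup hb ⟨1, h₁⟩
    have a₂ := le_ciSup hb ⟨z, hz⟩
    simp only [one_mul] at a₁ a₂ ⊢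
    cases abs_cases (extendZero F x z) <;> cases abs_cases (extendZero F x 1) <;> linarith
  rw [integral_div, integral_add i₃ i₄, integral_add i₁ i₂,
    integral_sub i₂.abs i₁.abs, integral_extendZero, integral_extendZero,
    hψ.integral_abs_eval h₁, hψ.integral_abs_eval hz, hψ.map_one] at hle
  simpa using hle

end GaussianMax

section WreathProduct

variable {H G : Type*} [Group H] [Group G]

lemma StandardWreath.inv_mul_left_apply (p q : StandardWreath H G) (z : G) :
    ((p⁻¹ * q).left : G → H) z =
      ((p.left : G → H) (p.right * z))⁻¹ * (q.left : G → H) (p.right * z) := by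
  simp [wreathShift]

lemma StandardWreath.finite_mulSupport (p : StandardWreath H G) :
    (Function.mulSupport (p.left : G → H)).Finite := p.left.2

/-- Summing a conditionally negative definite function of `H` over the lamps of `H ≀ G`. -/
lemma IsCNDFunction.finsum_left {ψ : H → ℝ} (hψ : IsCNDFunction ψ) :
    IsCNDFunction fun p : StandardWreath H G => ∑ᶠ z, ψ ((p.left : G → H) z) := by
  classical
  have key (p q : StandardWreath H G) : (∑ᶠ z, ψ (((p⁻¹ * q).left : G → H) z)) =
      ∑ᶠ z, ψ (((p.left : G → H) z)⁻¹ * (q.left : G → H) z) := by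
    simp_rw [StandardWreath.inv_mul_left_apply]
    exact finsum_comp_equiv (Equiv.mulLeft p.right)
      (f := fun z => ψ (((p.left : G → H) z)⁻¹ * (q.left : G → H) z))
  refine ⟨fun p q => ?_, fun p => ?_, fun n x c hc => ?_⟩
  · simp_rw [key]
    exact finsum_congr fun z => hψ.1 _ _
  · simp [hψ.map_one]
  · simp_rw [key]
    let D : Finset G := Finset.univ.biUnion fun i => (x i).finite_mulSupport.toFinset
    have hD (i j : Fin n) : (∑ᶠ z, ψ ((((x i).left : G → H) z)⁻¹ * ((x j).left : G → H) z)) =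
        ∑ z ∈ D, ψ ((((x i).left : G → H) z)⁻¹ * ((x j).left : G → H) z) := by
      refine finsum_eq_sum_of_support_subset _ fun z hz => ?_
      by_contra hzD
      have h (i : Fin n) : ((x i).left : G → H) z = 1 := by
        by_contra h
        exact hzD (by simpa [D] using ⟨i, h⟩)
      simp [h, hψ.map_one] at hz
    simp_rw [hD, Finset.mul_sum]
    simp_rw [Finset.sum_comm (t := D)]
    exact Finset.sum_nonpos fun z _ => hψ.2.2 n (fun i => ((x i).left : G → H) z) c hc

lemma IsCNDFunction.le_finsum_left {ψ : H → ℝ} (hψ : IsCNDFunction ψ)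
    (p : StandardWreath H G) (z : G) :
    ψ ((p.left : G → H) z) ≤ ∑ᶠ z, ψ ((p.left : G → H) z) := by
  refine single_le_finsum z (p.finite_mulSupport.subset fun y hy => ?_) fun y => hψ.nonneg _
  contrapose! hy
  simp_all [hψ.map_one]

open Classical in
lemma isCNDFunction_ite_one : IsCNDFunction fun h : H => if h = 1 then (0 : ℝ) else 1 := by
  refine ⟨fun x y => ?_, fun x => by simp, fun n x c hc => ?_⟩
  · simp only [inv_mul_eq_one, eq_comm]
  · have h := sum_mul_ite_eq_nonneg x c
    have hite (i j : Fin n) : (if (x i)⁻¹ * x j = 1 then (0 : ℝ) else 1) =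
        1 - (if x i = x j then 1 else 0) := by
      rw [inv_mul_eq_one]; split_ifs <;> simp
    simp_rw [hite, mul_sub, Finset.sum_sub_distrib, mul_one, ← Finset.sum_mul_sum, hc]
    simpa using h

open Classical in
lemma finsum_ite_one_eq_ncard (p : StandardWreath H G) :
    (∑ᶠ z, if (p.left : G → H) z = 1 then (0 : ℝ) else 1) =
      (Function.mulSupport (p.left : G → H)).ncard := by
  rw [finsum_eq_sum_of_support_subset (s := p.finite_mulSupport.toFinset) _ fun z hz => by
    simpa using hz, Set.ncard_eq_toFinset_card _ p.finite_mulSupport]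
  rw [Finset.sum_congr rfl (g := fun _ => 1) fun z hz => if_neg (by simpa using hz)]
  simp

open Classical in
/-- The identity, the cursor and the lit lamps of an element of `H ≀ G`. -/
noncomputable def StandardWreath.span (p : StandardWreath H G) : Finset G :=
  insert 1 (insert p.right p.finite_mulSupport.toFinset)

lemma StandardWreath.mem_span {p : StandardWreath H G} {z : G} :
    z ∈ p.span ↔ z = 1 ∨ z = p.right ∨ (p.left : G → H) z ≠ 1 := by
  simp [span]

lemma StandardWreath.one_mem_span (p : StandardWreath H G) : 1 ∈ p.span :=
  mem_span.2 (Or.inl rfl)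

lemma StandardWreath.forall_mem_span_inv_mul {P : G → Prop} (p q : StandardWreath H G) :
    (∀ z ∈ (p⁻¹ * q).span, P (p.right * z)) ↔
      P p.right ∧ P q.right ∧ ∀ y, (p.left : G → H) y ≠ (q.left : G → H) y → P y := by
  simp only [mem_span, inv_mul_left_apply, ne_eq, inv_mul_eq_one]
  constructor
  · intro h
    refine ⟨by simpa using h 1 (Or.inl rfl), by simpa using h (p⁻¹ * q).right (by simp),
      fun y hy => ?_⟩
    simpa using h (p.right⁻¹ * y) (Or.inr (Or.inr (by simpa using hy)))
  · rintro ⟨h₁, h₂, h₃⟩ z (rfl | rfl | hz)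
    · simpa using h₁
    · simpa using h₂
    · exact h₃ _ hz

lemma StandardWreath.iSup_span_le_iff (f : G → ℝ) (p q : StandardWreath H G) (t : ℝ) :
    (⨆ z : (p⁻¹ * q).span, f (p.right * z)) ≤ t ↔
      f p.right ≤ t ∧ f q.right ≤ t ∧
        ∀ y, (p.left : G → H) y ≠ (q.left : G → H) y → f y ≤ t := by
  have : Nonempty (p⁻¹ * q).span := ⟨1, one_mem_span _⟩
  rw [ciSup_le_iff (Finite.bddAbove_range _), Subtype.forall,
    forall_mem_span_inv_mul (P := fun z => f z ≤ t)]

lemma StandardWreath.sum_mul_iSup_span_nonpos (f : G → ℝ) (n : ℕ) (x : Fin n → StandardWreath H G)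
    (c : Fin n → ℝ) (hc : ∑ i, c i = 0) :
    ∑ i, ∑ j, c i * c j * (⨆ z : ((x i)⁻¹ * x j).span, f ((x i).right * z)) ≤ 0 := by
  classical
  refine sum_mul_nonpos_of_sublevel _ c hc fun t => ?_
  refine (sum_mul_ite_eq_nonneg
    (fun i (y : G) => if f y ≤ t then 1 else ((x i).left : G → H) y)
    (fun i => if f (x i).right ≤ t then c i else 0)).trans_eq ?_
  refine Finset.sum_congr rfl fun i _ => Finset.sum_congr rfl fun j _ => ?_
  have hr : ((fun y : G => if f y ≤ t then 1 else ((x i).left : G → H) y) =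
      fun y : G => if f y ≤ t then 1 else ((x j).left : G → H) y) ↔
      ∀ y, ((x i).left : G → H) y ≠ ((x j).left : G → H) y → f y ≤ t := by
    refine funext_iff.trans (forall_congr' fun y => ?_)
    by_cases h : f y ≤ t <;> simp [h]
  simp only [iSup_span_le_iff, hr]
  by_cases h₁ : f (x i).right ≤ t <;> by_cases h₂ : f (x j).right ≤ t <;> simp [h₁, h₂]

lemma IsCNDFunction.gaussianMax_inv_mul {ψ : G → ℝ} (hψ : IsCNDFunction ψ) {D : Finset G}
    {p q : StandardWreath H G} (hp : p.span ⊆ D) (hq : q.span ⊆ D) :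
    gaussianMax ψ (p⁻¹ * q).span =
      ∫ x, ⨆ z : (p⁻¹ * q).span, extendZero D x (p.right * z) ∂gaussianOn ψ D := by
  have hmem {r : StandardWreath H G} (hr : r.span ⊆ D) :
      r.right ∈ D ∧ ∀ y, (r.left : G → H) y ≠ 1 → y ∈ D :=
    ⟨hr (StandardWreath.mem_span.2 (by simp)),
      fun y hy => hr (StandardWreath.mem_span.2 (by simp [hy]))⟩
  refine hψ.gaussianMax_eq ⟨1, StandardWreath.one_mem_span _⟩ (hmem hp).1
    ((StandardWreath.forall_mem_span_inv_mul (P := (· ∈ D)) p q).2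
      ⟨(hmem hp).1, (hmem hq).1, fun y hy => ?_⟩)
  by_cases h : (p.left : G → H) y = 1
  · exact (hmem hq).2 y fun h' => hy (h.trans h'.symm)
  · exact (hmem hp).2 y h

/-- The expected maximum of the Gaussian process of `ψ` over the span of an element of `H ≀ G` is
conditionally negative definite. -/
lemma IsCNDFunction.gaussianMax_span {ψ : G → ℝ} (hψ : IsCNDFunction ψ) :
    IsCNDFunction fun p : StandardWreath H G => gaussianMax ψ p.span := by
  classical
  refine ⟨fun p q => ?_, fun p => ?_, fun n x c hc => ?_⟩
  · simp only
    rw [hψ.gaussianMax_inv_mul (D := p.span ∪ q.span) Finset.subset_union_left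
        Finset.subset_union_right,
      hψ.gaussianMax_inv_mul (D := p.span ∪ q.span) Finset.subset_union_right
        Finset.subset_union_left]
    refine integral_congr_ae (ae_of_all _ fun x => eq_of_forall_ge_iff fun t => ?_)
    rw [StandardWreath.iSup_span_le_iff, StandardWreath.iSup_span_le_iff]
    simp only [ne_comm, and_left_comm]
  · simp only
    rw [hψ.gaussianMax_inv_mul (D := p.span) subset_rfl subset_rfl]
    refine (integral_congr_ae (ae_of_all _ fun x => eq_of_forall_ge_iff fun t => ?_)).trans
      (integral_extendZero p.span p.right)
    rw [StandardWreath.iSup_span_le_iff]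
    simp
  · let D : Finset G := Finset.univ.biUnion fun i => (x i).span
    have hD (i : Fin n) : (x i).span ⊆ D :=
      Finset.subset_biUnion_of_mem (fun i => (x i).span) (Finset.mem_univ i)
    have hInt (i j : Fin n) := (integrable_iSup_extendZero (ψ := ψ) D ((x i)⁻¹ * x j).span
      (x i).right).const_mul (c i * c j)
    simp_rw [fun i j => hψ.gaussianMax_inv_mul (hD i) (hD j), ← integral_const_mul]
    simp_rw [← integral_finsetSum _ fun j _ => hInt _ j]
    rw [← integral_finsetSum _ fun i _ => integrable_finsetSum _ fun j _ => hInt i j]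
    exact integral_nonpos fun f =>
      StandardWreath.sum_mul_iSup_span_nonpos (extendZero D f) n x c hc

open Classical in
/-- The embedding of `H` into `H ≀ G` as the lamp group at `z`. -/
noncomputable def lampHom (H : Type*) [Group H] {G : Type*} (z : G) : H →* FinSuppSubgroup H G :=
  (MonoidHom.mulSingle (fun _ : G => H) z).codRestrict _ fun _ =>
    (Set.finite_singleton z).subset Pi.mulSupport_mulSingle_subset

open Classical in
lemma lampHom_apply {G : Type*} (z y : G) (h : H) :
    (lampHom H z h : G → H) y = if y = z then h else 1 :=
  Pi.mulSingle_apply z h y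

lemma inl_lampHom (z : G) (h : H) :
    (SemidirectProduct.inl (lampHom H z h) : StandardWreath H G) =
      SemidirectProduct.inr z * SemidirectProduct.inl (lampHom H 1 h) *
        SemidirectProduct.inr z⁻¹ := by
  rw [← SemidirectProduct.inl_aut]
  congr 1
  ext y
  have hy : z⁻¹ * y = 1 ↔ y = z := inv_mul_eq_one.trans eq_comm
  by_cases h' : y = z <;> simp [lampHom_apply, wreathShift, hy, h']

/-- A conditionally negative definite function on `H ≀ G` is bounded on lamp configurations whose
values and support lie in sets where it is bounded, and whose support has bounded size. -/
lemma IsCNDFunction.exists_bound_inl {Ψ : StandardWreath H G → ℝ} (hΨ : IsCNDFunction Ψ)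
    {Y : Set H} {Z : Set G} {A B : ℝ} (hA : ∀ z ∈ Z, Ψ (SemidirectProduct.inr z) ≤ A)
    (hB : ∀ h ∈ Y, Ψ (SemidirectProduct.inl (lampHom H 1 h)) ≤ B) (n : ℕ) :
    ∃ M : ℝ, ∀ w : FinSuppSubgroup H G, Function.mulSupport (w : G → H) ⊆ Z →
      (∀ z, (w : G → H) z ∈ Y ∪ {1}) → (Function.mulSupport (w : G → H)).ncard ≤ n →
        Ψ (SemidirectProduct.inl w) ≤ M := by
  classical
  induction n with
  | zero =>
    refine ⟨0, fun w _ _ hw => ?_⟩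
    rw [Nat.le_zero, Set.ncard_eq_zero w.2, Function.mulSupport_eq_empty_iff] at hw
    rw [show w = 1 from Subtype.ext hw, _root_.map_one, hΨ.map_one]
  | succ n ih =>
    obtain ⟨M, hM⟩ := ih
    refine ⟨max M (2 * (2 * (2 * A + 2 * B) + 2 * A) + 2 * M), fun w hZ hY hw => ?_⟩
    rcases Nat.lt_or_ge n (Function.mulSupport (w : G → H)).ncard with hn | hn
    · obtain ⟨z, hz⟩ := (Set.ncard_pos w.2).1 (n.zero_le.trans_lt hn)
      have hsplit (y : G) : (((lampHom H z ((w : G → H) z))⁻¹ * w : FinSuppSubgroup H G) : G → H) y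
          = if y = z then 1 else (w : G → H) y := by
        by_cases h : y = z
        · subst h; simp [lampHom_apply]
        · simp [lampHom_apply, h]
      have hsupp : Function.mulSupport
          (((lampHom H z ((w : G → H) z))⁻¹ * w : FinSuppSubgroup H G) : G → H) =
            Function.mulSupport (w : G → H) \ {z} := by
        ext y
        rw [Function.mem_mulSupport, hsplit]
        simp [and_comm]
      have h₁ := hM ((lampHom H z ((w : G → H) z))⁻¹ * w)
        (by rw [hsupp]; exact Set.sdiff_subset.trans hZ)
        (fun y => by
          rw [hsplit]
          split_ifs
          · simp
          · exact hY y)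
        (by
          rw [hsupp, Set.ncard_sdiff_singleton_of_mem hz]
          omega)
      have h₂ : Ψ (SemidirectProduct.inl (lampHom H z ((w : G → H) z))) ≤
          2 * (2 * A + 2 * B) + 2 * A := by
        rw [inl_lampHom]
        have hBz := hB _ ((hY z).resolve_right hz)
        have hAz := hA z (hZ hz)
        have hinv := hΨ.map_inv (SemidirectProduct.inr z)
        rw [← _root_.map_inv] at hinv
        refine (hΨ.map_mul_le _ _).trans ?_
        have := hΨ.map_mul_le (SemidirectProduct.inr z)
          (SemidirectProduct.inl (lampHom H 1 ((w : G → H) z)))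
        linarith
      have h₃ := hΨ.map_mul_le (SemidirectProduct.inl (lampHom H z ((w : G → H) z)))
        (SemidirectProduct.inl ((lampHom H z ((w : G → H) z))⁻¹ * w))
      rw [← _root_.map_mul, mul_inv_cancel_left] at h₃
      exact le_max_of_le_right (by linarith)
    · exact le_max_of_le_left (hM w hZ hY hn)

end WreathProduct

/-- **Theorem.** Characterization of subsets with relative Property (T) in a standard wreath
product `H ≀ G`: a subset `X` (of the underlying set `H^{(G)} × G`) has relative Property (T)
iff there are `Y ⊆ H`, `Z ⊆ G` with relative Property (T) such that every `(w,g) ∈ X` has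
`g ∈ Z`, `Supp(w) ⊆ Z`, values in `Y ∪ {1}`, and the size of supports is bounded on `X`. -/
theorem wreath_relative_T (H G : Type*) [Group H] [Group G] [Countable H] [Countable G]
    (X : Set (StandardWreath H G)) :
    RelPropT (StandardWreath H G) X ↔
      ∃ (Y : Set H) (Z : Set G),
        (∀ p ∈ X, p.right ∈ Z ∧
          Function.mulSupport (p.left : G → H) ⊆ Z ∧
          ∀ z : G, (p.left : G → H) z ∈ Y ∪ {1}) ∧
        RelPropT H Y ∧ RelPropT G Z ∧
        ∃ N : ℕ, ∀ p ∈ X, (Function.mulSupport (p.left : G → H)).ncard ≤ N := by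
  classical
  constructor
  · intro hX
    refine ⟨{h | ∃ p ∈ X, ∃ z, (p.left : G → H) z = h}, {z | ∃ p ∈ X, z ∈ p.span},
      fun p hp => ⟨⟨p, hp, StandardWreath.mem_span.2 (by simp)⟩,
        fun z hz => ⟨p, hp, StandardWreath.mem_span.2 (Or.inr (Or.inr hz))⟩,
        fun z => Or.inl ⟨p, hp, z, rfl⟩⟩, fun ψ hψ => ?_, fun ψ hψ => ?_, ?_⟩
    · obtain ⟨M, hM⟩ := hX _ hψ.finsum_left
      refine ⟨M, ?_⟩
      rintro _ ⟨p, hp, z, rfl⟩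
      exact (hψ.le_finsum_left p z).trans (hM p hp)
    · obtain ⟨M, hM⟩ := hX _ hψ.gaussianMax_span
      refine ⟨(M * 2 / ∫ x, |x| ∂ProbabilityTheory.gaussianReal 0 1) ^ 2, ?_⟩
      rintro z ⟨p, hp, hz⟩
      have h := (hψ.sqrt_le_gaussianMax p.one_mem_span hz).trans (hM p hp)
      rw [div_le_iff₀ two_pos, ← le_div_iff₀ integral_abs_gaussianReal_pos] at h
      exact (Real.sqrt_le_left ((Real.sqrt_nonneg _).trans h)).1 h
    · obtain ⟨M, hM⟩ := hX _ isCNDFunction_ite_one.finsum_left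
      obtain ⟨N, hN⟩ := exists_nat_ge M
      refine ⟨N, fun p hp => ?_⟩
      have h := (hM p hp).trans hN
      rw [finsum_ite_one_eq_ncard] at h
      exact_mod_cast h
  · rintro ⟨Y, Z, hXYZ, hY, hZ, N, hN⟩ Ψ hΨ
    obtain ⟨A, hA⟩ := hZ _ (hΨ.comp_monoidHom SemidirectProduct.inr)
    obtain ⟨B, hB⟩ := hY _ (hΨ.comp_monoidHom (SemidirectProduct.inl.comp (lampHom H (1 : G))))
    obtain ⟨M, hM⟩ := hΨ.exists_bound_inl hA hB N
    refine ⟨2 * M + 2 * A, fun p hp => ?_⟩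
    obtain ⟨hright, hsupp, hval⟩ := hXYZ p hp
    have h₁ := hM p.left hsupp hval (hN p hp)
    have h₂ : Ψ (SemidirectProduct.inr p.right) ≤ A := hA _ hright
    have h₃ := hΨ.map_mul_le (SemidirectProduct.inl p.left) (SemidirectProduct.inr p.right)
    rw [SemidirectProduct.inl_left_mul_inr_right] at h₃
    linarith
end

section
/- Let G be a countable group, X a countable G-set, W a countable group on which G acts by automorphisms, and φ an 𝒜-gauge on W (𝒜 = finite subsets of X) with φ(w,w) = ∅, which is W-invariant (φ(ww′,ww″) = φ(w′,w″) for all w,w′,w″ ∈ W) and G-equivariant (φ(g·w, g·w′) = g·φ(w,w′)). Let (X, μ) be a G-invariant measured walls structure. Then there exists a measured walls structure μ̃ on W × X, invariant under the action of W ⋊ G given by (w,g)·(w′,x) = (w·(g·w′), g·x), whose associated pseudo-distance is d_μ̃((w₁,x₁),(w₂,x₂)) = μ({A ⊆ X : A ⊢ φ(w₁,w₂) ∪ {x₁,x₂}}). -/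
open MeasureTheory Function Set
open scoped ENNReal
/-- A Borel measure on the power set `2^X`, identified with `X → Bool` endowed with the
product topology (and its Borel σ-algebra). -/
noncomputable abbrev WallMeasure (X : Type*) := @MeasureTheory.Measure (X → Bool) (borel _)

/-- The pseudo-distance associated to a wall measure:
`d_μ(x,y) = μ {A | exactly one of x, y belongs to A}`. -/
def wallDist {X : Type*} (μ : WallMeasure X) (x y : X) : ℝ≥0∞ :=
  μ {A | A x ≠ A y}

/-- A measured walls structure: all wall pseudo-distances are finite. -/
def IsMWS {X : Type*} (μ : WallMeasure X) : Prop :=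
  ∀ x y : X, wallDist μ x y < ⊤

/-- Pushforward of wall measures. -/
noncomputable def wallMap {X Y : Type*} (f : (X → Bool) → (Y → Bool)) (μ : WallMeasure X) :
    WallMeasure Y :=
  @MeasureTheory.Measure.map _ _ (borel _) (borel _) f μ

/-- Left invariance of a wall measure on a group, for the action `(k·A)(x) = A(k⁻¹x)`. -/
def IsLeftInvariantWalls {K : Type*} [Group K] (μ : WallMeasure K) : Prop :=
  ∀ k : K, wallMap (fun A x => A (k⁻¹ * x)) μ = μ

/-- `A ⊢ F` : the half-space `A` cuts the subset `F`, i.e. `F` is neither contained in `A`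
nor in its complement. -/
def CutsB {X : Type*} (A : X → Bool) (F : Set X) : Prop :=
  (∃ x ∈ F, A x = true) ∧ (∃ x ∈ F, A x = false)

section CountRange

variable {ι α β : Type*} [MeasurableSpace α] [MeasurableSpace β]

/-- The number of distinct values of a countable measurable family lying in a measurable set
depends measurably on the parameter. -/
theorem measurable_encard_inter_range [Countable ι] {c : ι → α → β} (hc : ∀ i, Measurable (c i))
    (heq : ∀ i j, MeasurableSet {a | c i a = c j a}) {s : Set β} (hs : MeasurableSet s) :
    Measurable fun a => ((s ∩ range fun i => c i a).encard : ℝ≥0∞) := by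
  obtain ⟨e, he⟩ := exists_injective_nat ι
  let first : ι → Set α := fun i => {a | c i a ∈ s ∧ ∀ j, e j < e i → c j a ≠ c i a}
  have hfirst : ∀ i, MeasurableSet (first i) := fun i => by
    refine (hc i hs).inter (?_ : MeasurableSet {a | ∀ j, e j < e i → c j a ≠ c i a})
    simp only [ofPred_forall]
    exact .iInter fun j => .iInter fun _ => (heq j i).compl
  have key : (fun a => ((s ∩ range fun i => c i a).encard : ℝ≥0∞)) =
      fun a => ∑' i, (first i).indicator 1 a := by
    funext a
    have himg : (s ∩ range fun i => c i a) = (fun i => c i a) '' {i | a ∈ first i} := by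
      ext b
      constructor
      · rintro ⟨hb, hr⟩
        obtain ⟨i, hi, hmin⟩ := (measure e).wf.has_min {i | c i a = b} hr
        refine ⟨i, ⟨hi.symm ▸ hb, fun j hj hji => ?_⟩, hi⟩
        exact hmin j (hji.trans hi) hj
      · rintro ⟨i, hi, rfl⟩
        exact ⟨hi.1, i, rfl⟩
    have hinj : InjOn (fun i => c i a) {i | a ∈ first i} := by
      intro i hi j hj hij
      refine he (le_antisymm ?_ ?_)
      · exact not_lt.1 fun h => hi.2 j h hij.symm
      · exact not_lt.1 fun h => hj.2 i h hij
    rw [himg, hinj.encard_image, ← ENNReal.tsum_set_one, tsum_subtype _ fun _ => (1 : ℝ≥0∞)]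
    rfl
  rw [key]
  exact Measurable.tsum fun i => measurable_one.indicator (hfirst i)

/-- Half the `μ`-average of the counting measures on the sets of values of the family `c`. -/
noncomputable def halfCountRange (μ : Measure α) (c : ι → α → β) : Measure β :=
  (2⁻¹ : ℝ≥0∞) • μ.bind fun a => Measure.count.restrict (range fun i => c i a)

theorem halfCountRange_apply [Countable ι] [MeasurableSingletonClass β] (μ : Measure α)
    {c : ι → α → β} (hc : ∀ i, Measurable (c i))
    (heq : ∀ i j, MeasurableSet {a | c i a = c j a}) {s : Set β} (hs : MeasurableSet s) :
    halfCountRange μ c s = 2⁻¹ * ∫⁻ a, ((s ∩ range fun i => c i a).encard : ℝ≥0∞) ∂μ := by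
  have hcount : ∀ (t : Set β), MeasurableSet t → ∀ a,
      Measure.count.restrict (range fun i => c i a) t =
        ((t ∩ range fun i => c i a).encard : ℝ≥0∞) := fun t ht a => by
    rw [Measure.restrict_apply ht, Measure.count_apply (ht.inter (countable_range _).measurableSet)]
  have hmeas : Measurable fun a => Measure.count.restrict (range fun i => c i a) :=
    Measure.measurable_of_measurable_coe _ fun t ht => by
      simpa only [hcount t ht] using measurable_encard_inter_range hc heq ht
  rw [halfCountRange, Measure.smul_apply, Measure.bind_apply hs hmeas.aemeasurable, smul_eq_mul]
  simp only [hcount s hs]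

theorem map_halfCountRange [Countable ι] [MeasurableSingletonClass β] {μ : Measure α}
    {c : ι → α → β} (hc : ∀ i, Measurable (c i))
    (heq : ∀ i j, MeasurableSet {a | c i a = c j a})
    {g : α → α} (hg : Measurable g) (hμ : μ.map g = μ)
    {T : β → β} (hT : Measurable T) (hTinj : Injective T)
    {σ : ι → ι} (hσ : Surjective σ) (hequiv : ∀ i a, c i (g a) = T (c (σ i) a)) :
    (halfCountRange μ c).map T = halfCountRange μ c := by
  ext s hs
  rw [Measure.map_apply hT hs, halfCountRange_apply μ hc heq (hT hs),
    halfCountRange_apply μ hc heq hs]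
  conv_rhs => rw [← hμ, lintegral_map (measurable_encard_inter_range hc heq hs) hg]
  congr 2 with a
  have hrange : (range fun i => c i (g a)) = T '' range fun i => c i a := by
    simp only [hequiv]
    rw [← range_comp]
    exact hσ.range_comp fun i => T (c i a)
  rw [hrange, inter_comm s, ← image_inter_preimage, hTinj.encard_image, inter_comm]

/-- If `s` contains no value of the family but the `i`-th and `j`-th ones, and contains these
exactly when they differ, then its measure is that of the set where they differ. -/
theorem halfCountRange_eq_measure_ne [Countable ι] [MeasurableSingletonClass β] (μ : Measure α)
    {c : ι → α → β} (hc : ∀ i, Measurable (c i))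
    (heq : ∀ i j, MeasurableSet {a | c i a = c j a}) {s : Set β} (hs : MeasurableSet s) {i j : ι}
    (hsep : ∀ a k, c k a ∈ s ↔ c i a ≠ c j a ∧ (c k a = c i a ∨ c k a = c j a)) :
    halfCountRange μ c s = μ {a | c i a ≠ c j a} := by
  have hencard : ∀ a, ((s ∩ range fun k => c k a).encard : ℝ≥0∞) =
      {a | c i a ≠ c j a}.indicator (fun _ => 2) a := fun a => by
    by_cases h : c i a = c j a
    · have : (s ∩ range fun k => c k a) = ∅ := by
        rw [eq_empty_iff_forall_notMem]
        rintro _ ⟨hk, k, rfl⟩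
        exact ((hsep a k).1 hk).1 h
      simp [this, h]
    · have : (s ∩ range fun k => c k a) = {c i a, c j a} := by
        ext b
        constructor
        · rintro ⟨hk, k, rfl⟩
          exact ((hsep a k).1 hk).2
        · rintro (rfl | rfl)
          · exact ⟨(hsep a i).2 ⟨h, .inl rfl⟩, i, rfl⟩
          · exact ⟨(hsep a j).2 ⟨h, .inr rfl⟩, j, rfl⟩
      rw [this, encard_pair h]
      simp [h]
  rw [halfCountRange_apply μ hc heq hs]
  simp only [hencard]
  have hsep_meas : MeasurableSet {a | c i a ≠ c j a} := (heq i j).compl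
  rw [lintegral_indicator_const hsep_meas, ← mul_assoc,
    ENNReal.inv_mul_cancel two_ne_zero ENNReal.ofNat_ne_top, one_mul]

end CountRange

section Cuts

variable {X Y : Type*}

theorem cutsB_image {f : Y → X} {A : X → Bool} {F : Set Y} :
    CutsB A (f '' F) ↔ CutsB (fun y => A (f y)) F := by
  simp [CutsB]

theorem not_cutsB_iff {A : X → Bool} {F : Set X} {x : X} (hx : x ∈ F) :
    ¬ CutsB A F ↔ ∀ y ∈ F, A y = A x := by
  unfold CutsB
  constructor
  · intro h y hy
    by_contra hne
    cases hAx : A x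
    · exact h ⟨⟨y, hy, by simpa [hAx] using hne⟩, ⟨x, hx, hAx⟩⟩
    · exact h ⟨⟨x, hx, hAx⟩, ⟨y, hy, by simpa [hAx] using hne⟩⟩
  · rintro h ⟨⟨y, hy, hy'⟩, ⟨z, hz, hz'⟩⟩
    simp [h z hz, ← h y hy, hy'] at hz'

theorem isClopen_setOf_apply_eq (x : X) (b : Bool) : IsClopen {A : X → Bool | A x = b} :=
  (isClopen_discrete {b}).preimage (continuous_apply x)

theorem isClopen_setOf_cutsB {F : Set X} (hF : F.Finite) :
    IsClopen {A : X → Bool | CutsB A F} := by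
  have h : ∀ b, IsClopen {A : X → Bool | ∃ x ∈ F, A x = b} := fun b => by
    simp only [← exists_prop, ofPred_exists]
    simpa using hF.isClopen_biUnion fun x _ => isClopen_setOf_apply_eq x b
  exact (h true).inter (h false)

theorem IsMWS.measure_cutsB_lt_top {μ : WallMeasure X} (hμ : IsMWS μ) {F : Set X}
    (hF : F.Finite) {x : X} (hx : x ∈ F) : μ {A | CutsB A F} < ⊤ := by
  let _ : MeasurableSpace (X → Bool) := borel _
  have hsub : {A : X → Bool | CutsB A F} ⊆ ⋃ y ∈ F, {A | A y ≠ A x} := fun A hA => by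
    by_contra h
    refine (not_cutsB_iff hx).2 (fun y hy => ?_) hA
    by_contra hne
    exact h (mem_biUnion hy hne)
  exact (measure_mono hsub).trans_lt (measure_biUnion_lt_top hF fun y _ => hμ y x)

end Cuts

section GaugeClass

variable {W X : Type*}

/-- The set `φ(w,w') ∪ {x,x'}` attached to a pair of points of `W × X`. -/
def gaugeHull (φ : W → W → Finset X) (p q : W × X) : Set X :=
  (φ p.1 q.1 : Set X) ∪ {p.2, q.2}

theorem finite_gaugeHull (φ : W → W → Finset X) (p q : W × X) : (gaugeHull φ p q).Finite :=
  (φ p.1 q.1).finite_toSet.union (toFinite _)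

theorem left_mem_gaugeHull (φ : W → W → Finset X) (p q : W × X) : p.2 ∈ gaugeHull φ p q :=
  .inr (.inl rfl)

theorem right_mem_gaugeHull (φ : W → W → Finset X) (p q : W × X) : q.2 ∈ gaugeHull φ p q :=
  .inr (.inr rfl)

open scoped Classical in
/-- The half-space of `W × X` formed by the points `q` such that `A` does not cut
`gaugeHull φ p q`. -/
noncomputable def gaugeClass (φ : W → W → Finset X) (p : W × X) (A : X → Bool) : W × X → Bool :=
  fun q => decide (¬ CutsB A (gaugeHull φ p q))

theorem gaugeClass_eq_true {φ : W → W → Finset X} {p q : W × X} {A : X → Bool} :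
    gaugeClass φ p A q = true ↔ ¬ CutsB A (gaugeHull φ p q) := by
  simp [gaugeClass]

theorem continuous_gaugeClass (φ : W → W → Finset X) (p : W × X) :
    Continuous (gaugeClass φ p) := by
  refine continuous_pi fun q => (continuous_bool_rng true).2 ?_
  have : (fun A => gaugeClass φ p A q) ⁻¹' {true} = {A | CutsB A (gaugeHull φ p q)}ᶜ := by
    ext A
    exact gaugeClass_eq_true
  rw [this]
  exact (isClopen_setOf_cutsB (finite_gaugeHull φ p q)).compl

variable [DecidableEq X] {φ : W → W → Finset X}

theorem gaugeClass_equivalence (hsymm : ∀ w w', φ w w' = φ w' w)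
    (htri : ∀ w w' w'', φ w w'' ⊆ φ w w' ∪ φ w' w'') (hdiag : ∀ w, φ w w = ∅) (A : X → Bool) :
    Equivalence fun p q => gaugeClass φ p A q = true := by
  simp only [gaugeClass_eq_true]
  refine ⟨fun p => ?_, fun {p q} h => ?_, fun {p q r} hpq hqr => ?_⟩
  · rw [not_cutsB_iff (left_mem_gaugeHull φ p p)]
    simp [gaugeHull, hdiag]
  · rwa [gaugeHull, hsymm, pair_comm]
  · rw [not_cutsB_iff (right_mem_gaugeHull φ p q)] at hpq
    rw [not_cutsB_iff (left_mem_gaugeHull φ q r)] at hqr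
    have hsub : ∀ y ∈ gaugeHull φ p r, A y = A q.2 := by
      rintro y (hy | rfl | rfl)
      · rcases Finset.mem_union.1 (htri p.1 q.1 r.1 hy) with h | h
        · exact hpq y (.inl h)
        · exact hqr y (.inl h)
      · exact hpq _ (left_mem_gaugeHull φ p q)
      · exact hqr _ (right_mem_gaugeHull φ q r)
    rw [not_cutsB_iff (left_mem_gaugeHull φ p r)]
    exact fun y hy => (hsub y hy).trans (hsub _ (left_mem_gaugeHull φ p r)).symm

theorem gaugeClass_eq_iff (hsymm : ∀ w w', φ w w' = φ w' w)
    (htri : ∀ w w' w'', φ w w'' ⊆ φ w w' ∪ φ w' w'') (hdiag : ∀ w, φ w w = ∅) {A : X → Bool}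
    {p q : W × X} : gaugeClass φ p A = gaugeClass φ q A ↔ gaugeClass φ p A q = true := by
  have e := gaugeClass_equivalence hsymm htri hdiag A
  refine ⟨fun h => h ▸ e.refl q, fun h => funext fun r => Bool.eq_iff_iff.2 ?_⟩
  exact ⟨fun h' => e.trans (e.symm h) h', fun h' => e.trans h h'⟩

end GaugeClass

theorem gaugeHull_smul {G W X : Type*} [Group G] [Group W] [MulAction G X]
    [MulDistribMulAction G W] {φ : W → W → Finset X}
    (hWinv : ∀ w w' w'' : W, φ (w * w') (w * w'') = φ w' w'')
    (hGequiv : ∀ (g : G) (w w' : W),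
      (φ (g • w) (g • w') : Set X) = (fun x => g • x) '' (φ w w' : Set X))
    (w : W) (g : G) (p q : W × X) :
    gaugeHull φ (g • (w * p.1), g • p.2) (g • (w * q.1), g • q.2) =
      (fun x => g • x) '' gaugeHull φ p q := by
  simp only [gaugeHull, hGequiv, hWinv, image_union, image_pair]

open scoped Classical in
/-- **Theorem (equivariant lifting of measured walls structures).** Let `G` act on a countable
set `X` and by automorphisms on a countable group `W`, let `φ` be a `W`-invariant,
`G`-equivariant `𝒜`-gauge on `W` with `φ(w,w) = ∅`, and let `μ` be a `G`-invariant measured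
walls structure on `X`. Then there is a measured walls structure `μ̃` on `W × X`, invariant
under the `W ⋊ G`-action `(w,g)·(w′,x) = (w·(g·w′), g·x)`, with
`d_μ̃((w₁,x₁),(w₂,x₂)) = μ {A | A ⊢ φ(w₁,w₂) ∪ {x₁,x₂}}`. -/
theorem lift_walls_equivariant {G W X : Type*} [Group G] [Group W]
    [Countable G] [Countable W] [Countable X]
    [MulAction G X] [MulDistribMulAction G W]
    (φ : W → W → Finset X)
    (hsymm : ∀ w w', φ w w' = φ w' w)
    (htri : ∀ w w' w'', φ w w'' ⊆ φ w w' ∪ φ w' w'')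
    (hdiag : ∀ w, φ w w = ∅)
    (hWinv : ∀ w w' w'' : W, φ (w * w') (w * w'') = φ w' w'')
    (hGequiv : ∀ (g : G) (w w' : W),
      (φ (g • w) (g • w') : Set X) = (fun x => g • x) '' (φ w w' : Set X))
    (μ : WallMeasure X) (hμ : IsMWS μ)
    (hinv : ∀ g : G, wallMap (fun A x => A (g⁻¹ • x)) μ = μ) :
    ∃ ν : WallMeasure (W × X), IsMWS ν ∧
      (∀ (w : W) (g : G),
        wallMap (fun B (p : W × X) => B (g⁻¹ • (w⁻¹ * p.1), g⁻¹ • p.2)) ν = ν) ∧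
      ∀ (w₁ w₂ : W) (x₁ x₂ : X),
        wallDist ν (w₁, x₁) (w₂, x₂) =
          μ {A | CutsB A ((φ w₁ w₂ : Set X) ∪ {x₁, x₂})} := by
  let _ : MeasurableSpace (X → Bool) := borel _
  let _ : MeasurableSpace (W × X → Bool) := borel _
  have : BorelSpace (X → Bool) := ⟨rfl⟩
  have : BorelSpace (W × X → Bool) := ⟨rfl⟩
  have hc : ∀ p : W × X, Measurable (gaugeClass φ p) := fun p =>
    (continuous_gaugeClass φ p).measurable
  have hne : ∀ p q : W × X, {A | gaugeClass φ p A ≠ gaugeClass φ q A} =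
      {A | CutsB A (gaugeHull φ p q)} := fun p q => by
    ext A
    simp [gaugeClass_eq_iff hsymm htri hdiag, gaugeClass]
  have heq : ∀ p q : W × X, MeasurableSet {A | gaugeClass φ p A = gaugeClass φ q A} := fun p q => by
    rw [← MeasurableSet.compl_iff]
    exact (congrArg MeasurableSet (hne p q)).mpr
      (isClopen_setOf_cutsB (finite_gaugeHull φ p q)).isOpen.measurableSet
  have hdist : ∀ p q : W × X, wallDist (halfCountRange μ (gaugeClass φ)) p q =
      μ {A | CutsB A (gaugeHull φ p q)} := fun p q => by
    have hs : MeasurableSet {B : W × X → Bool | B p ≠ B q} :=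
      (isOpen_ne_fun (continuous_apply p) (continuous_apply q)).measurableSet
    rw [← hne]
    refine halfCountRange_eq_measure_ne μ hc heq hs fun A r => ?_
    have e := gaugeClass_equivalence hsymm htri hdiag A
    rw [mem_ofPred_eq, ne_eq, Bool.eq_iff_iff]
    simp only [ne_eq, gaugeClass_eq_iff hsymm htri hdiag]
    have h₁ := e.symm (x := r) (y := p)
    have h₂ := e.trans (x := p) (y := r) (z := q)
    have h₃ := e.trans (x := r) (y := p) (z := q)
    have h₄ := e.trans (x := r) (y := q) (z := p)
    have h₅ := e.symm (x := p) (y := q)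
    tauto
  refine ⟨halfCountRange μ (gaugeClass φ), fun p q => ?_, fun w g => ?_,
    fun w₁ w₂ x₁ x₂ => hdist _ _⟩
  · rw [hdist]
    exact hμ.measure_cutsB_lt_top (finite_gaugeHull φ p q) (left_mem_gaugeHull φ p q)
  · let σ : W × X → W × X := fun p => (g⁻¹ • (w⁻¹ * p.1), g⁻¹ • p.2)
    have hσ : Surjective σ := fun p => ⟨(w * g • p.1, g • p.2), by simp [σ]⟩
    refine map_halfCountRange (σ := σ) hc heq (g := fun A x => A (g⁻¹ • x))
      (by fun_prop : Continuous _).measurable (hinv g) (by fun_prop : Continuous _).measurable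
      hσ.injective_comp_right hσ fun p A => ?_
    funext q
    rw [Bool.eq_iff_iff, gaugeClass_eq_true, gaugeClass_eq_true,
      gaugeHull_smul hWinv hGequiv, cutsB_image]
end
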